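/- Let g = 1/138 and δ ∈ (0,1], and let F = (X,Y,A,B,V) be a free game with |X| and |Y| even and ω(F) ≤ 1 − δ/2. Let (x,y) be a (1−4gδ)-UNE of G(F,g,δ) whose question marginals satisfy ‖x'‖₁ ≥ 1 − gδ and ‖y'‖₁ ≥ 1 − gδ, and in which for every question there is at most one answer played with positive probability. Then both players' payoffs under (x,y) are at most 1 − gδ. -/

import Mathlib

open Finset

section Bimatrix

variable {I J : Type*} [Fintype I] [Fintype J]

/-- A mixed strategy: a probability distribution on a finite type. -/
def IsDist (x : I → ℝ) : Prop := (∀ i, 0 ≤ x i) ∧ ∑ i, x i = 1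

/-- Expected payoff `xᵀ M y`. -/
noncomputable def pay (M : I → J → ℝ) (x : I → ℝ) (y : J → ℝ) : ℝ :=
  ∑ i, ∑ j, x i * M i j * y j

/-- `(M y)_i`, the payoff of pure row `i` against mixed strategy `y`. -/
noncomputable def rowPay (M : I → J → ℝ) (y : J → ℝ) (i : I) : ℝ := ∑ j, M i j * y j

/-- `(xᵀ M)_j`, the payoff of pure column `j` against mixed strategy `x`. -/
noncomputable def colPay (M : I → J → ℝ) (x : I → ℝ) (j : J) : ℝ := ∑ i, x i * M i j

/-- Social welfare. -/
noncomputable def sw (R C : I → J → ℝ) (x : I → ℝ) (y : J → ℝ) : ℝ := pay R x y + pay C x y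

/-- `(x,y)` is an ε-approximate Nash equilibrium of the bimatrix game `(R,C)`. -/
def IsEpsNE (R C : I → J → ℝ) (x : I → ℝ) (y : J → ℝ) (ε : ℝ) : Prop :=
  IsDist x ∧ IsDist y ∧
  (∀ i, rowPay R y i - pay R x y ≤ ε) ∧
  (∀ j, colPay C x j - pay C x y ≤ ε)

/-- `(x,y)` is an ε-well-supported Nash equilibrium of `(R,C)`. -/
def IsEpsWSNE (R C : I → J → ℝ) (x : I → ℝ) (y : J → ℝ) (ε : ℝ) : Prop :=
  IsDist x ∧ IsDist y ∧
  (∀ i, 0 < x i → ∀ k, rowPay R y k - rowPay R y i ≤ ε) ∧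
  (∀ j, 0 < y j → ∀ k, colPay C x k - colPay C x j ≤ ε)

end Bimatrix

/-- ℓ₁ norm of a finitely-indexed real vector. -/
noncomputable def l1 {I : Type*} [Fintype I] (v : I → ℝ) : ℝ := ∑ i, |v i|

section FreeGame

variable {X Y A B : Type*} [Fintype X] [Fintype Y] [Fintype A] [Fintype B]

/-- Payoff of a strategy pair in the free game with verifier `V`. -/
noncomputable def freePayoff (V : X → Y → A → B → ℝ) (s₁ : X → A) (s₂ : Y → B) : ℝ :=
  (1 / ((Fintype.card X : ℝ) * (Fintype.card Y : ℝ))) * ∑ x, ∑ y, V x y (s₁ x) (s₂ y)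

/-- Value `ω(F)` of the free game: the best payoff over all strategy pairs. -/
noncomputable def gameValue [Nonempty A] [Nonempty B] (V : X → Y → A → B → ℝ) : ℝ :=
  ⨆ s : (X → A) × (Y → B), freePayoff V s.1 s.2

end FreeGame

/-- Functions selecting exactly half of the elements of a finite type. -/
abbrev HalfFns (Y : Type*) [Fintype Y] : Type _ :=
  {f : Y → Bool // 2 * (Finset.univ.filter (fun y => f y = true)).card = Fintype.card Y}

section GGame

variable {X Y A B : Type*} [Fintype X] [Fintype Y] [Fintype A] [Fintype B]

/-- Row player's payoffs in the game `G(F,g,δ)`. -/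
noncomputable def GRow (V : X → Y → A → B → ℝ) (g δ : ℝ) :
    X × A ⊕ HalfFns Y → Y × B ⊕ HalfFns X → ℝ
  | Sum.inl (q, a), Sum.inl (r, b) => V q r a b
  | Sum.inr f, Sum.inl (r, _) => if f.1 r then 4 / (1 + 4 * g * δ) else 0
  | Sum.inl (q, _), Sum.inr f => -(if f.1 q then 4 / (1 + 4 * g * δ) else 0)
  | Sum.inr _, Sum.inr _ => 0

/-- Column player's payoffs in the game `G(F,g,δ)`. -/
noncomputable def GCol (V : X → Y → A → B → ℝ) (g δ : ℝ) :
    X × A ⊕ HalfFns Y → Y × B ⊕ HalfFns X → ℝ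
  | Sum.inl (q, a), Sum.inl (r, b) => V q r a b
  | Sum.inr f, Sum.inl (r, _) => -(if f.1 r then 4 / (1 + 4 * g * δ) else 0)
  | Sum.inl (q, _), Sum.inr f => if f.1 q then 4 / (1 + 4 * g * δ) else 0
  | Sum.inr _, Sum.inr _ => 0

/-- Question marginal of a row-player mixed strategy of `G(F,g,δ)`. -/
noncomputable def rowMarg (x : X × A ⊕ HalfFns Y → ℝ) (q : X) : ℝ := ∑ a, x (Sum.inl (q, a))

/-- Question marginal of a column-player mixed strategy of `G(F,g,δ)`. -/
noncomputable def colMarg (y : Y × B ⊕ HalfFns X → ℝ) (r : Y) : ℝ := ∑ b, y (Sum.inl (r, b))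

/-- Payoff of the two-prover game `T_{(x,y)}` with question distributions `x'`, `y'`. -/
noncomputable def tpPay (V : X → Y → A → B → ℝ) (x' : X → ℝ) (y' : Y → ℝ)
    (s₁ : X → A) (s₂ : Y → B) : ℝ :=
  ∑ q, ∑ r, x' q * y' r * V q r (s₁ q) (s₂ r)

/-- Row payoffs of the rescaled game `G_s(F,g,δ)`. -/
noncomputable def GsRow (V : X → Y → A → B → ℝ) (g δ : ℝ)
    (i : X × A ⊕ HalfFns Y) (j : Y × B ⊕ HalfFns X) : ℝ := (GRow V g δ i j + 4) / 8

/-- Column payoffs of the rescaled game `G_s(F,g,δ)`. -/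
noncomputable def GsCol (V : X → Y → A → B → ℝ) (g δ : ℝ)
    (i : X × A ⊕ HalfFns Y) (j : Y × B ⊕ HalfFns X) : ℝ := (GCol V g δ i j + 4) / 8

/-- Row payoffs of `G'(F)`, extending `G_s` by a new row `𝔦` and a new column `𝔧`
(the `Sum.inr` components); here `ε* = (1 - 4gδ)/8`. -/
noncomputable def G'Row (V : X → Y → A → B → ℝ) (g δ : ℝ) :
    (X × A ⊕ HalfFns Y) ⊕ Unit → (Y × B ⊕ HalfFns X) ⊕ Unit → ℝ
  | Sum.inl i, Sum.inl j => GsRow V g δ i j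
  | Sum.inr _, Sum.inl _ => 5 / 8 + (1 - 4 * g * δ) / 8
  | Sum.inl _, Sum.inr _ => 0
  | Sum.inr _, Sum.inr _ => 1

/-- Column payoffs of `G'(F)`. -/
noncomputable def G'Col (V : X → Y → A → B → ℝ) (g δ : ℝ) :
    (X × A ⊕ HalfFns Y) ⊕ Unit → (Y × B ⊕ HalfFns X) ⊕ Unit → ℝ
  | Sum.inl i, Sum.inl j => GsCol V g δ i j
  | Sum.inr _, Sum.inl _ => 0
  | Sum.inl _, Sum.inr _ => 5 / 8 + (1 - 4 * g * δ) / 8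
  | Sum.inr _, Sum.inr _ => 1

/-- Row payoffs of `G''(F)`, extending `G'` by a new row `𝔦'` and a new column `𝔧'`. -/
noncomputable def G''Row (V : X → Y → A → B → ℝ) (g δ : ℝ) :
    ((X × A ⊕ HalfFns Y) ⊕ Unit) ⊕ Unit → ((Y × B ⊕ HalfFns X) ⊕ Unit) ⊕ Unit → ℝ
  | Sum.inl i, Sum.inl j => G'Row V g δ i j
  | Sum.inr _, Sum.inl _ => 5 / 8
  | Sum.inl _, Sum.inr _ => 5 / 8
  | Sum.inr _, Sum.inr _ => 0

/-- Column payoffs of `G''(F)`. -/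
noncomputable def G''Col (V : X → Y → A → B → ℝ) (g δ : ℝ) :
    ((X × A ⊕ HalfFns Y) ⊕ Unit) ⊕ Unit → ((Y × B ⊕ HalfFns X) ⊕ Unit) ⊕ Unit → ℝ
  | Sum.inl i, Sum.inl j => G'Col V g δ i j
  | Sum.inr _, Sum.inl _ => 5 / 8
  | Sum.inl _, Sum.inr _ => 5 / 8
  | Sum.inr _, Sum.inr _ => 0

end GGame

section ClauseVar

variable {Vars : Type*}

/-- An assignment `α` satisfies a 3-clause `c` (a literal `(v, b)` stands for `v`
if `b = true` and for `¬v` if `b = false`). -/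
def SatClause (α : Vars → Bool) (c : Finset (Vars × Bool)) : Prop :=
  ∃ l ∈ c, α l.1 = l.2

open Classical in
/-- The verifier of the clause–variable free game associated to partitions
`S` of the variables and `T` of the clauses. -/
noncomputable def clauseVarV {m : ℕ} (S : Fin m → Finset Vars)
    (T : Fin m → Finset (Finset (Vars × Bool)))
    (i j : Fin m) (α β : Vars → Bool) : ℝ :=
  if (∀ c ∈ T j, SatClause β c) ∧
      (∀ v ∈ S i, (∃ c ∈ T j, ∃ p : Bool, (v, p) ∈ c) → α v = β v) then 1 else 0

end ClauseVar

section HalfSums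

variable {Y : Type*} [Fintype Y] [DecidableEq Y]

/-- If a function is nonnegative on a set with at least half of the points and its sum over every
half-size set is at most `c`, then its sum over the set is at most `2 * c`. -/
lemma sum_le_two_mul_of_half_sums_le {k : ℕ} (hk : Fintype.card Y = 2 * k) {d : Y → ℝ} {c : ℝ}
    (hc : ∀ f : Finset Y, #f = k → ∑ r ∈ f, d r ≤ c) {S : Finset Y} (hS : k ≤ #S)
    (hd : ∀ r ∈ S, 0 ≤ d r) : ∑ r ∈ S, d r ≤ 2 * c := by
  obtain ⟨f, hfS, hf⟩ := exists_subset_card_eq hS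
  have hcard : #(S \ f) ≤ k := by
    have h₁ := card_sdiff_of_subset hfS
    have h₂ := card_le_univ S
    omega
  obtain ⟨t, hft, htS, ht⟩ := exists_subsuperset_card_eq (sdiff_subset (s := S) (t := f)) hcard hS
  have h₁ : ∑ r ∈ S \ f, d r ≤ ∑ r ∈ t, d r :=
    sum_le_sum_of_subset_of_nonneg hft fun r hr _ => hd r (htS hr)
  have h₂ := sum_sdiff hfS (f := d)
  linarith [hc f hf, hc t ht]

/-- A near-probability vector whose mass on every half of the points is at most `1 / 2 + 2 * e`
exceeds the uniform distribution by at most `6 * e` in total. -/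
lemma sum_posPart_sub_uniform_le [Nonempty Y] {k : ℕ} (hk : Fintype.card Y = 2 * k) {m : Y → ℝ}
    {e : ℝ} (he : 0 ≤ e) (hm : 1 - e ≤ ∑ r, m r) (hm' : ∑ r, m r ≤ 1)
    (hc : ∀ f : Finset Y, #f = k → ∑ r ∈ f, m r ≤ 1 / 2 + 2 * e) :
    ∑ r, max (m r - 1 / (Fintype.card Y : ℝ)) 0 ≤ 6 * e := by
  set u : ℝ := 1 / (Fintype.card Y : ℝ) with hu
  have hcard : (0 : ℝ) < Fintype.card Y := by exact_mod_cast Fintype.card_pos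
  have hku : (k : ℝ) * u = 1 / 2 := by
    have : (Fintype.card Y : ℝ) = 2 * k := by exact_mod_cast hk
    rw [hu]
    field_simp
    linarith
  have hsum : ∀ f : Finset Y, #f = k → ∑ r ∈ f, (m r - u) = ∑ r ∈ f, m r - 1 / 2 := by
    intro f hf
    rw [sum_sub_distrib, sum_const, hf, nsmul_eq_mul, hku]
  have hupper : ∀ f : Finset Y, #f = k → ∑ r ∈ f, (m r - u) ≤ 2 * e := by
    intro f hf
    linarith [hsum f hf, hc f hf]
  have hlower : ∀ f : Finset Y, #f = k → ∑ r ∈ f, -(m r - u) ≤ 3 * e := by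
    intro f hf
    have h₁ : #fᶜ = k := by rw [card_compl]; omega
    have h₂ := sum_add_sum_compl f m
    rw [sum_neg_distrib]
    linarith [hsum f hf, hc fᶜ h₁]
  set S : Finset Y := univ.filter fun r => 0 < m r - u with hS
  have hpos : ∑ r, max (m r - u) 0 = ∑ r ∈ S, (m r - u) := by
    rw [hS, sum_filter]
    refine sum_congr rfl fun r _ => ?_
    split_ifs with h
    · exact max_eq_left h.le
    · exact max_eq_right (not_lt.mp h)
  rw [hpos]
  rcases le_total k #S with h | h
  · have := sum_le_two_mul_of_half_sums_le hk hupper h fun r hr => (mem_filter.mp hr).2.le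
    linarith
  · have hScompl : k ≤ #Sᶜ := by rw [card_compl]; omega
    have h₁ := sum_le_two_mul_of_half_sums_le hk hlower hScompl fun r hr => by
      rw [hS, mem_compl, mem_filter, not_and, not_lt] at hr
      linarith [hr (mem_univ r)]
    have h₂ := sum_add_sum_compl S fun r => m r - u
    have h₃ : ∑ r, (m r - u) = ∑ r, m r - 1 := by
      rw [sum_sub_distrib, sum_const, card_univ, nsmul_eq_mul, hu, mul_one_div_cancel hcard.ne']
    rw [sum_neg_distrib] at h₁
    linarith

end HalfSums

section Value

variable {X Y A B : Type*} [Fintype X] [Fintype Y]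

lemma freePayoff_le_gameValue [Fintype A] [Fintype B] [Nonempty A] [Nonempty B]
    (V : X → Y → A → B → ℝ)
    (s₁ : X → A) (s₂ : Y → B) : freePayoff V s₁ s₂ ≤ gameValue V := by
  classical
  exact le_ciSup (f := fun s : (X → A) × (Y → B) => freePayoff V s.1 s.2)
    (Set.finite_range _).bddAbove (s₁, s₂)

/-- Changing uniform question distributions to `x'`, `y'` increases the payoff by at most the
total excesses of `x'` and `y'` over the uniform distributions. -/
lemma tpPay_le_freePayoff_add [Nonempty X] [Nonempty Y] {V : X → Y → A → B → ℝ}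
    (hV₀ : ∀ q r a b, 0 ≤ V q r a b) (hV₁ : ∀ q r a b, V q r a b ≤ 1)
    {x' : X → ℝ} {y' : Y → ℝ} (hy₀ : ∀ r, 0 ≤ y' r) (hy₁ : ∑ r, y' r ≤ 1)
    (s₁ : X → A) (s₂ : Y → B) :
    tpPay V x' y' s₁ s₂ ≤ freePayoff V s₁ s₂ + ∑ q, max (x' q - 1 / (Fintype.card X : ℝ)) 0 +
      ∑ r, max (y' r - 1 / (Fintype.card Y : ℝ)) 0 := by
  have hX : (0 : ℝ) < Fintype.card X := by exact_mod_cast Fintype.card_pos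
  have hY : (0 : ℝ) < Fintype.card Y := by exact_mod_cast Fintype.card_pos
  set u : ℝ := 1 / (Fintype.card X : ℝ) with hu
  set v : ℝ := 1 / (Fintype.card Y : ℝ) with hv
  have hu₀ : 0 < u := by positivity
  have hpt : ∀ q r, x' q * y' r * V q r (s₁ q) (s₂ r) ≤
      u * v * V q r (s₁ q) (s₂ r) + max (x' q - u) 0 * y' r + u * max (y' r - v) 0 := by
    intro q r
    have h₀ := hV₀ q r (s₁ q) (s₂ r)
    have h₁ := hV₁ q r (s₁ q) (s₂ r)
    set w := V q r (s₁ q) (s₂ r)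
    have hp : x' q ≤ u + max (x' q - u) 0 := by linarith [le_max_left (x' q - u) 0]
    have hp' : y' r ≤ v + max (y' r - v) 0 := by linarith [le_max_left (y' r - v) 0]
    have hp₀ := le_max_right (x' q - u) 0
    have hp₀' := le_max_right (y' r - v) 0
    have e₁ := mul_le_mul_of_nonneg_right hp (mul_nonneg (hy₀ r) h₀)
    have e₂ := mul_le_mul_of_nonneg_left hp' (mul_nonneg hu₀.le h₀)
    have e₃ := mul_le_mul_of_nonneg_left h₁ (mul_nonneg hp₀ (hy₀ r))
    have e₄ := mul_le_mul_of_nonneg_left h₁ (mul_nonneg hu₀.le hp₀')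
    linarith
  have hfree : ∑ q, ∑ r, u * v * V q r (s₁ q) (s₂ r) = freePayoff V s₁ s₂ := by
    simp only [freePayoff, ← mul_sum, hu, hv]
    ring
  have hx : ∑ q, ∑ r, max (x' q - u) 0 * y' r ≤ ∑ q, max (x' q - u) 0 := by
    refine sum_le_sum fun q _ => ?_
    rw [← mul_sum]
    exact mul_le_of_le_one_right (le_max_right _ _) hy₁
  have hy : ∑ _q : X, ∑ r, u * max (y' r - v) 0 = ∑ r, max (y' r - v) 0 := by
    rw [sum_const, card_univ, nsmul_eq_mul, ← mul_sum, ← mul_assoc, hu,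
      mul_one_div_cancel hX.ne', one_mul]
  calc tpPay V x' y' s₁ s₂
      ≤ ∑ q, ∑ r, (u * v * V q r (s₁ q) (s₂ r) + max (x' q - u) 0 * y' r +
          u * max (y' r - v) 0) := sum_le_sum fun q _ => sum_le_sum fun r _ => hpt q r
    _ ≤ _ := by
      simp only [sum_add_distrib]
      rw [hfree, hy]
      linarith

lemma tpPay_le_one {V : X → Y → A → B → ℝ} (hV₁ : ∀ q r a b, V q r a b ≤ 1)
    {x' : X → ℝ} {y' : Y → ℝ} (hx₀ : ∀ q, 0 ≤ x' q) (hx₁ : ∑ q, x' q ≤ 1)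
    (hy₀ : ∀ r, 0 ≤ y' r) (hy₁ : ∑ r, y' r ≤ 1) (s₁ : X → A) (s₂ : Y → B) :
    tpPay V x' y' s₁ s₂ ≤ 1 :=
  calc tpPay V x' y' s₁ s₂ ≤ ∑ q, ∑ r, x' q * y' r := sum_le_sum fun q _ => sum_le_sum fun r _ =>
        mul_le_of_le_one_right (mul_nonneg (hx₀ q) (hy₀ r)) (hV₁ _ _ _ _)
    _ = (∑ q, x' q) * ∑ r, y' r := (sum_mul_sum _ _ _ _).symm
    _ ≤ 1 := mul_le_one₀ hx₁ (sum_nonneg fun r _ => hy₀ r) hy₁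

end Value

section Game

variable {X Y A B : Type*}

/-- A nonnegative vector supported on at most one answer per question is given by its question
marginal and an answer function. -/
lemma exists_answer_of_unique [Fintype Y] [Fintype A] [Nonempty A]
    {x : X × A ⊕ HalfFns Y → ℝ} (hx : ∀ i, 0 ≤ x i)
    (hxu : ∀ q (a₁ a₂ : A), 0 < x (Sum.inl (q, a₁)) → 0 < x (Sum.inl (q, a₂)) → a₁ = a₂) :
    ∃ s : X → A, ∀ q (φ : A → ℝ),
      ∑ a, x (Sum.inl (q, a)) * φ a = rowMarg x q * φ (s q) := by
  classical
  have h : ∀ q, ∃ s : A, ∀ a, a ≠ s → x (Sum.inl (q, a)) = 0 := by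
    intro q
    by_cases hq : ∃ a, 0 < x (Sum.inl (q, a))
    · obtain ⟨s, hs⟩ := hq
      exact ⟨s, fun a ha => ((hx _).eq_or_lt.resolve_right fun h => ha (hxu q a s h hs)).symm⟩
    · push Not at hq
      exact ⟨Classical.arbitrary A, fun a _ => le_antisymm (hq a) (hx _)⟩
  choose s hs using h
  refine ⟨s, fun q φ => ?_⟩
  rw [rowMarg, sum_eq_single (s q) (fun a _ ha => by rw [hs q a ha, zero_mul]) (by simp),
    sum_eq_single (s q) (fun a _ ha => hs q a ha) (by simp)]

lemma GCol_eq_GRow_swap [Fintype X] [Fintype Y] (V : X → Y → A → B → ℝ) (g δ : ℝ)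
    (i : X × A ⊕ HalfFns Y) (j : Y × B ⊕ HalfFns X) :
    GCol V g δ i j = GRow (fun r q b a => V q r a b) g δ j i := by
  rcases i with ⟨q, a⟩ | f <;> rcases j with ⟨r, b⟩ | f' <;> rfl

lemma sum_rowMarg_add [Fintype X] [Fintype Y] [Fintype A] [DecidableEq Y]
    {x : X × A ⊕ HalfFns Y → ℝ} (hx : IsDist x) :
    ∑ q, rowMarg x q + ∑ f, x (Sum.inr f) = 1 := by
  have h := hx.2
  rwa [Fintype.sum_sum_type, Fintype.sum_prod_type] at h

lemma sum_rowMarg_le_one [Fintype X] [Fintype Y] [Fintype A] [DecidableEq Y]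
    {x : X × A ⊕ HalfFns Y → ℝ} (hx : IsDist x) :
    ∑ q, rowMarg x q ≤ 1 := by
  linarith [sum_rowMarg_add hx, sum_nonneg fun (f : HalfFns Y) (_ : f ∈ univ) => hx.1 (Sum.inr f)]

/-- The payoff of a pure row in `H_Y` in terms of the column player's question marginal. -/
lemma rowPay_GRow_inr [Fintype X] [Fintype Y] [Fintype B] [DecidableEq X]
    (V : X → Y → A → B → ℝ) (g δ : ℝ) (y : Y × B ⊕ HalfFns X → ℝ)
    (f : HalfFns Y) :
    rowPay (GRow V g δ) y (Sum.inr f) =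
      4 / (1 + 4 * g * δ) * ∑ r with f.1 r = true, colMarg y r := by
  simp only [rowPay, Fintype.sum_sum_type, Fintype.sum_prod_type, GRow, zero_mul, sum_const_zero,
    add_zero, sum_filter, mul_sum, colMarg]
  refine sum_congr rfl fun r _ => ?_
  split_ifs <;> simp [mul_sum]

variable [Fintype X] [Fintype Y] [Fintype A] [Fintype B] [DecidableEq X] [DecidableEq Y]

/-- The row player gains at most `4` on each unit of mass on `H_Y`. -/
lemma pay_GRow_le {V : X → Y → A → B → ℝ} {g δ : ℝ} (hg : 0 ≤ g * δ)
    {x : X × A ⊕ HalfFns Y → ℝ} {y : Y × B ⊕ HalfFns X → ℝ} (hx : IsDist x) (hy : IsDist y) :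
    pay (GRow V g δ) x y ≤
      (∑ q, ∑ r, ∑ a, x (Sum.inl (q, a)) * ∑ b, y (Sum.inl (r, b)) * V q r a b) +
        4 * ∑ f, x (Sum.inr f) := by
  have hD₀ : 0 ≤ 4 / (1 + 4 * g * δ) := by
    apply div_nonneg <;> linarith
  have hD : 4 / (1 + 4 * g * δ) ≤ 4 := by
    rw [div_le_iff₀] <;> linarith
  have hmarg : ∑ p : Y × B, y (Sum.inl p) ≤ 1 := by
    have h := hy.2
    rw [Fintype.sum_sum_type] at h
    linarith [sum_nonneg fun (f : HalfFns X) (_ : f ∈ univ) => hy.1 (Sum.inr f)]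
  have hH : ∑ f : HalfFns Y, ∑ p : Y × B,
      x (Sum.inr f) * GRow V g δ (Sum.inr f) (Sum.inl p) * y (Sum.inl p) ≤
        4 * ∑ f, x (Sum.inr f) := by
    rw [mul_sum]
    refine sum_le_sum fun f _ => ?_
    calc ∑ p : Y × B, x (Sum.inr f) * GRow V g δ (Sum.inr f) (Sum.inl p) * y (Sum.inl p)
        ≤ ∑ p : Y × B, x (Sum.inr f) * 4 * y (Sum.inl p) := by
          refine sum_le_sum fun p _ => ?_
          have h : GRow V g δ (Sum.inr f) (Sum.inl p) ≤ 4 := by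
            simp only [GRow]
            split_ifs <;> linarith
          exact mul_le_mul_of_nonneg_right (mul_le_mul_of_nonneg_left h (hx.1 _)) (hy.1 _)
      _ = 4 * x (Sum.inr f) * ∑ p : Y × B, y (Sum.inl p) := by
          rw [mul_sum]
          exact sum_congr rfl fun p _ => by ring
      _ ≤ 4 * x (Sum.inr f) :=
          mul_le_of_le_one_right (mul_nonneg (by norm_num) (hx.1 _)) hmarg
  have hneg : ∑ p : X × A, ∑ f : HalfFns X,
      x (Sum.inl p) * GRow V g δ (Sum.inl p) (Sum.inr f) * y (Sum.inr f) ≤ 0 := by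
    refine sum_nonpos fun p _ => sum_nonpos fun f _ => ?_
    refine mul_nonpos_of_nonpos_of_nonneg (mul_nonpos_of_nonneg_of_nonpos (hx.1 _) ?_) (hy.1 _)
    simp only [GRow]
    split_ifs <;> linarith
  have hmain : ∑ p : X × A, ∑ p' : Y × B,
      x (Sum.inl p) * GRow V g δ (Sum.inl p) (Sum.inl p') * y (Sum.inl p') =
        ∑ q, ∑ r, ∑ a, x (Sum.inl (q, a)) * ∑ b, y (Sum.inl (r, b)) * V q r a b := by
    rw [Fintype.sum_prod_type]
    refine sum_congr rfl fun q _ => ?_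
    rw [sum_comm, Fintype.sum_prod_type]
    refine sum_congr rfl fun r _ => ?_
    rw [sum_comm]
    refine sum_congr rfl fun a _ => ?_
    rw [mul_sum]
    exact sum_congr rfl fun b _ => by simp only [GRow]; ring
  have hzero : ∑ f : HalfFns Y, ∑ f' : HalfFns X,
      x (Sum.inr f) * GRow V g δ (Sum.inr f) (Sum.inr f') * y (Sum.inr f') = 0 := by
    simp [GRow]
  simp only [pay, Fintype.sum_sum_type, sum_add_distrib]
  linarith

/-- In an approximate equilibrium of `G(F,g,δ)` the row player's incentives force the column
player's question marginal to exceed the uniform distribution only slightly. -/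
lemma sum_posPart_colMarg_le [Nonempty Y] {V : X → Y → A → B → ℝ} {g δ : ℝ} (hg : 0 ≤ g * δ)
    (hY : Even (Fintype.card Y)) {x : X × A ⊕ HalfFns Y → ℝ} {y : Y × B ⊕ HalfFns X → ℝ}
    (hpay : pay (GRow V g δ) x y ≤ 1 + 4 * (g * δ))
    (hm : 1 - g * δ ≤ ∑ r, colMarg y r) (hm' : ∑ r, colMarg y r ≤ 1)
    (hne : ∀ i, rowPay (GRow V g δ) y i - pay (GRow V g δ) x y ≤ 1 - 4 * g * δ) :
    ∑ r, max (colMarg y r - 1 / (Fintype.card Y : ℝ)) 0 ≤ 6 * (g * δ) := by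
  obtain ⟨k, hk⟩ := hY
  rw [← two_mul] at hk
  refine sum_posPart_sub_uniform_le hk hg hm hm' fun s hs => ?_
  have hfilter : univ.filter (fun r => decide (r ∈ s) = true) = s := by
    ext r
    simp
  have h := hne (Sum.inr ⟨fun r => decide (r ∈ s), by rw [hfilter, hs, hk]⟩)
  rw [rowPay_GRow_inr, hfilter] at h
  have hpos : 0 < 1 + 4 * g * δ := by linarith
  have h₂ : 4 / (1 + 4 * g * δ) * ∑ r ∈ s, colMarg y r ≤ 2 := by linarith
  rw [div_mul_eq_mul_div, div_le_iff₀ hpos] at h₂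
  linarith

/-- With unique answers, payoffs in `G(F,g,δ)` are those of a two-prover game up to the mass the
row player puts on `H_Y`. -/
lemma exists_pay_GRow_le_tpPay [Nonempty A] [Nonempty B] {V : X → Y → A → B → ℝ} {g δ : ℝ}
    (hg : 0 ≤ g * δ)
    {x : X × A ⊕ HalfFns Y → ℝ} {y : Y × B ⊕ HalfFns X → ℝ} (hx : IsDist x) (hy : IsDist y)
    (hxm : 1 - g * δ ≤ ∑ q, rowMarg x q)
    (hxu : ∀ q (a₁ a₂ : A), 0 < x (Sum.inl (q, a₁)) → 0 < x (Sum.inl (q, a₂)) → a₁ = a₂)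
    (hyu : ∀ r (b₁ b₂ : B), 0 < y (Sum.inl (r, b₁)) → 0 < y (Sum.inl (r, b₂)) → b₁ = b₂) :
    ∃ s₁ s₂, pay (GRow V g δ) x y ≤ tpPay V (rowMarg x) (colMarg y) s₁ s₂ + 4 * (g * δ) := by
  obtain ⟨s₁, hs₁⟩ := exists_answer_of_unique hx.1 hxu
  obtain ⟨s₂, hs₂⟩ := exists_answer_of_unique hy.1 hyu
  refine ⟨s₁, s₂, (pay_GRow_le hg hx hy).trans ?_⟩
  have h := sum_rowMarg_add hx
  have heq : (∑ q, ∑ r, ∑ a, x (Sum.inl (q, a)) * ∑ b, y (Sum.inl (r, b)) * V q r a b) =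
      tpPay V (rowMarg x) (colMarg y) s₁ s₂ := by
    refine sum_congr rfl fun q _ => sum_congr rfl fun r _ => ?_
    rw [hs₁ q fun a => ∑ b, y (Sum.inl (r, b)) * V q r a b, hs₂ r (V q r (s₁ q)), mul_assoc]
    rfl
  rw [heq]
  linarith

end Game

/-- Lemma 11, soundness: with `g = 1/138`, if `ω(F) ≤ 1 - δ/2`, then in
any `(1-4gδ)`-UNE of `G(F,g,δ)` with question-marginal mass at least `1 - gδ` and at most
one answer played per question, both players have payoff at most `1 - gδ`. -/
theorem soundness_payoff_bound {X Y A B : Type*}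
    [Fintype X] [Fintype Y] [Fintype A] [Fintype B]
    [DecidableEq X] [DecidableEq Y]
    [Nonempty X] [Nonempty Y] [Nonempty A] [Nonempty B]
    (V : X → Y → A → B → ℝ) (hV : ∀ x y a b, V x y a b = 0 ∨ V x y a b = 1)
    (hX : Even (Fintype.card X)) (hY : Even (Fintype.card Y))
    (g δ : ℝ) (hg : g = 1 / 138) (hδ0 : 0 < δ) (hδ : δ ≤ 1)
    (hω : gameValue V ≤ 1 - δ / 2)
    (x : X × A ⊕ HalfFns Y → ℝ) (y : Y × B ⊕ HalfFns X → ℝ)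
    (hne : IsEpsNE (GRow V g δ) (GCol V g δ) x y (1 - 4 * g * δ))
    (hxm : 1 - g * δ ≤ l1 (rowMarg x)) (hym : 1 - g * δ ≤ l1 (colMarg y))
    (hxu : ∀ q (a₁ a₂ : A), 0 < x (Sum.inl (q, a₁)) → 0 < x (Sum.inl (q, a₂)) → a₁ = a₂)
    (hyu : ∀ r (b₁ b₂ : B), 0 < y (Sum.inl (r, b₁)) → 0 < y (Sum.inl (r, b₂)) → b₁ = b₂) :
    pay (GRow V g δ) x y ≤ 1 - g * δ ∧ pay (GCol V g δ) x y ≤ 1 - g * δ := by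
  have he : 0 ≤ g * δ := by rw [hg]; positivity
  have hV₀ : ∀ q r a b, 0 ≤ V q r a b := fun q r a b => by
    rcases hV q r a b with h | h <;> simp [h]
  have hV₁ : ∀ q r a b, V q r a b ≤ 1 := fun q r a b => by
    rcases hV q r a b with h | h <;> simp [h]
  obtain ⟨hx, hy, hrow, hcol⟩ := hne
  have hx₀ : ∀ q, 0 ≤ rowMarg x q := fun q => sum_nonneg fun a _ => hx.1 _
  have hy₀ : ∀ r, 0 ≤ colMarg y r := fun r => sum_nonneg fun b _ => hy.1 _
  have hx₁ : ∑ q, rowMarg x q ≤ 1 := sum_rowMarg_le_one hx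
  have hy₁ : ∑ r, colMarg y r ≤ 1 := sum_rowMarg_le_one hy
  simp only [l1, abs_of_nonneg (hx₀ _)] at hxm
  simp only [l1, abs_of_nonneg (hy₀ _)] at hym
  let W : Y → X → B → A → ℝ := fun r q b a => V q r a b
  have hpayC : pay (GCol V g δ) x y = pay (GRow W g δ) y x := by
    simp only [pay, GCol_eq_GRow_swap]
    rw [sum_comm]
    exact sum_congr rfl fun j _ => sum_congr rfl fun i _ => by ring
  have hcolC : ∀ j, colPay (GCol V g δ) x j = rowPay (GRow W g δ) x j := fun j => by
    simp only [colPay, rowPay, GCol_eq_GRow_swap]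
    exact sum_congr rfl fun i _ => mul_comm _ _
  simp only [hpayC, hcolC] at hcol
  have hswap : ∀ s₂ s₁, tpPay W (colMarg y) (rowMarg x) s₂ s₁ =
      tpPay V (rowMarg x) (colMarg y) s₁ s₂ := fun s₂ s₁ => by
    simp only [tpPay]
    rw [sum_comm]
    exact sum_congr rfl fun q _ => sum_congr rfl fun r _ => by ring
  obtain ⟨s₁, s₂, hR⟩ := exists_pay_GRow_le_tpPay (V := V) he hx hy hxm hxu hyu
  obtain ⟨t₂, t₁, hC⟩ := exists_pay_GRow_le_tpPay (V := W) he hy hx hym hyu hxu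
  change pay (GRow W g δ) y x ≤ tpPay W (colMarg y) (rowMarg x) t₂ t₁ + 4 * (g * δ) at hC
  rw [hswap] at hC
  have hone := tpPay_le_one hV₁ hx₀ hx₁ hy₀ hy₁
  have hYexc := sum_posPart_colMarg_le he hY (by linarith [hone s₁ s₂]) hym hy₁ hrow
  have hXexc : ∑ q, max (rowMarg x q - 1 / (Fintype.card X : ℝ)) 0 ≤ 6 * (g * δ) :=
    sum_posPart_colMarg_le he hX (by linarith [hone t₁ t₂]) hxm hx₁ hcol
  have hval : ∀ s₁ s₂, tpPay V (rowMarg x) (colMarg y) s₁ s₂ ≤ 1 - 69 * (g * δ) + 12 * (g * δ) := by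
    intro s₁ s₂
    have h₁ := tpPay_le_freePayoff_add hV₀ hV₁ (x' := rowMarg x) hy₀ hy₁ s₁ s₂
    have h₂ := freePayoff_le_gameValue V s₁ s₂
    have h₃ : 69 * (g * δ) = δ / 2 := by rw [hg]; ring
    linarith
  rw [hpayC]
  constructor
  · linarith [hval s₁ s₂]
  · linarith [hval t₁ t₂]
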